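/- For every n ≥ 2, the real Lie algebra 𝔰𝔱(n, ℝ) of upper triangular n × n real matrices of trace zero (with bracket [A,B] = AB − BA) is Lie contractible: there exists a family θ_t (t ∈ ℝ) of Lie algebra endomorphisms of 𝔰𝔱(n, ℝ) such that θ_t is the identity for t ≤ 0, θ_t = 0 for t ≥ 1, and (t, A) ↦ θ_t(A) is C^∞. -/

import Mathlib

/-- The weight by which the entry `(i, j)` is multiplied: `u` on the diagonal and `s ^ (j - i)`
off the diagonal. -/
def triangularWeight {n : ℕ} (s u : ℝ) (i j : Fin n) : ℝ :=
  if i = j then u else s ^ (j.val - i.val)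

/-- Entrywise multiplication by `triangularWeight s u` is multiplicative on commutator terms of
upper triangular matrices as soon as `s = 0` or `u = 1`. -/
theorem triangularWeight_mul_commutator {n : ℕ} {s u : ℝ} (h : s = 0 ∨ u = 1)
    {A B : Fin n → Fin n → ℝ} (hA : ∀ i j : Fin n, j < i → A i j = 0)
    (hB : ∀ i j : Fin n, j < i → B i j = 0) (i j k : Fin n) :
    triangularWeight s u i j * (A i k * B k j - B i k * A k j) =
      triangularWeight s u i k * triangularWeight s u k j * (A i k * B k j - B i k * A k j) := by
  have key : ∀ m : ℕ, 0 < m → u * s ^ m = s ^ m := by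
    intro m hm
    rcases h with rfl | rfl
    · simp [hm.ne']
    · simp
  rcases lt_or_ge k i with hki | hik
  · simp [hA i k hki, hB i k hki]
  rcases lt_or_ge j k with hjk | hkj
  · simp [hA k j hjk, hB k j hjk]
  rcases hik.eq_or_lt with rfl | hik
  · rcases hkj.eq_or_lt with rfl | hkj
    · rw [mul_comm (B i i), sub_self, mul_zero, mul_zero]
    · have hlt : i.val < j.val := hkj
      simp only [triangularWeight, hkj.ne, if_true, if_false]
      rw [key _ (by omega)]
  · have hik' : i.val < k.val := hik
    rcases hkj.eq_or_lt with rfl | hkj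
    · simp only [triangularWeight, hik.ne, if_true, if_false]
      rw [mul_comm _ u, key _ (by omega)]
    · have hkj' : k.val < j.val := hkj
      simp only [triangularWeight, hik.ne, hkj.ne, (hik.trans hkj).ne, if_false]
      rw [← pow_add]
      congr 2
      omega

/-- A map into a finite-dimensional submodule is smooth if it is smooth as a map into the ambient
space. -/
theorem contDiff_of_contDiff_coe {E V : Type*} [NormedAddCommGroup E] [NormedSpace ℝ E]
    [NormedAddCommGroup V] [NormedSpace ℝ V] [FiniteDimensional ℝ V] (S : Submodule ℝ V)
    {m : WithTop ℕ∞} {f : E → S} (hf : ContDiff ℝ m fun x => (f x : V)) : ContDiff ℝ m f := by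
  obtain ⟨P, hP⟩ := S.subtype.exists_leftInverse_of_injective S.ker_subtype
  have h := (LinearMap.toContinuousLinearMap P).contDiff.comp hf
  convert h using 1
  funext x
  exact (LinearMap.congr_fun hP (f x)).symm


/-- For every `n ≥ 2` the real Lie algebra `𝔰𝔱(n, ℝ)` of upper
triangular `n × n` real matrices of trace zero (with bracket `[A,B] = AB − BA`) is
Lie contractible: there is a family `θ t` of Lie algebra endomorphisms of `𝔰𝔱(n, ℝ)`
(linear maps preserving the commutator bracket) with `θ t = id` for `t ≤ 0`, `θ t = 0`
for `t ≥ 1`, and `(t, A) ↦ θ t A` of class `C^∞` on `ℝ × 𝔰𝔱(n, ℝ)`.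

Here `𝔰𝔱(n, ℝ)` is encoded as the submodule of `Fin n → Fin n → ℝ` (the space of `n × n`
matrices) consisting of the upper triangular matrices of trace zero, and bracket
preservation is stated via the commutator of the corresponding matrices. -/
theorem st_lieContractible (n : ℕ) (hn : 2 ≤ n)
    (𝔰𝔱 : Submodule ℝ (Fin n → Fin n → ℝ))
    (h𝔰𝔱 : ∀ A : Fin n → Fin n → ℝ,
      A ∈ 𝔰𝔱 ↔ (∀ i j : Fin n, j < i → A i j = 0) ∧ Matrix.trace (Matrix.of A) = 0) :
    ∃ θ : ℝ → (𝔰𝔱 →ₗ[ℝ] 𝔰𝔱),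
      (∀ t : ℝ, t ≤ 0 → θ t = LinearMap.id) ∧
      (∀ t : ℝ, 1 ≤ t → θ t = 0) ∧
      (∀ (t : ℝ) (A B C : 𝔰𝔱),
        Matrix.of (C : Fin n → Fin n → ℝ) =
            Matrix.of (A : Fin n → Fin n → ℝ) * Matrix.of (B : Fin n → Fin n → ℝ) -
              Matrix.of (B : Fin n → Fin n → ℝ) * Matrix.of (A : Fin n → Fin n → ℝ) →
        Matrix.of ((θ t C : 𝔰𝔱) : Fin n → Fin n → ℝ) =
            Matrix.of ((θ t A : 𝔰𝔱) : Fin n → Fin n → ℝ) *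
                Matrix.of ((θ t B : 𝔰𝔱) : Fin n → Fin n → ℝ) -
              Matrix.of ((θ t B : 𝔰𝔱) : Fin n → Fin n → ℝ) *
                Matrix.of ((θ t A : 𝔰𝔱) : Fin n → Fin n → ℝ)) ∧
      ContDiff ℝ (⊤ : ℕ∞) fun p : ℝ × 𝔰𝔱 => (θ p.1 p.2 : 𝔰𝔱) := by
  set s : ℝ → ℝ := fun t => 1 - Real.smoothTransition (2 * t) with hs
  set u : ℝ → ℝ := fun t => 1 - Real.smoothTransition (2 * t - 1) with hu
  have hsu : ∀ t, s t = 0 ∨ u t = 1 := by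
    intro t
    rcases le_total 1 (2 * t) with ht | ht
    · left
      simp [hs, Real.smoothTransition.one_of_one_le ht]
    · right
      simp [hu, Real.smoothTransition.zero_of_nonpos (sub_nonpos.2 ht)]
  have hs_smooth : ContDiff ℝ (⊤ : ℕ∞) s :=
    contDiff_const.sub (Real.smoothTransition.contDiff.comp (contDiff_const.mul contDiff_id))
  have hu_smooth : ContDiff ℝ (⊤ : ℕ∞) u :=
    contDiff_const.sub (Real.smoothTransition.contDiff.comp
      ((contDiff_const.mul contDiff_id).sub contDiff_const))
  have upper : ∀ A : 𝔰𝔱, ∀ i j : Fin n, j < i → (A : Fin n → Fin n → ℝ) i j = 0 :=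
    fun A => ((h𝔰𝔱 A).1 A.2).1
  let θ : ℝ → (𝔰𝔱 →ₗ[ℝ] 𝔰𝔱) := fun t =>
    { toFun := fun A => ⟨fun i j => triangularWeight (s t) (u t) i j *
          (A : Fin n → Fin n → ℝ) i j, by
        refine (h𝔰𝔱 _).2 ⟨fun i j hij => by rw [upper A i j hij, mul_zero], ?_⟩
        have htr := ((h𝔰𝔱 A).1 A.2).2
        simp only [Matrix.trace, Matrix.diag, Matrix.of_apply] at htr ⊢
        simp [triangularWeight, ← Finset.mul_sum, htr]⟩
      map_add' := fun A B => by
        ext i j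
        simp [mul_add]
      map_smul' := fun c A => by
        ext i j
        simp [mul_left_comm] }
  have hθ : ∀ t (A : 𝔰𝔱) i j, (θ t A : Fin n → Fin n → ℝ) i j =
      triangularWeight (s t) (u t) i j * (A : Fin n → Fin n → ℝ) i j := fun _ _ _ _ => rfl
  refine ⟨θ, fun t ht => ?_, fun t ht => ?_, fun t A B C h => ?_, ?_⟩
  · have hs1 : s t = 1 := by
      simp [hs, Real.smoothTransition.zero_of_nonpos (show 2 * t ≤ 0 by linarith)]
    have hu1 : u t = 1 := by
      simp [hu, Real.smoothTransition.zero_of_nonpos (show 2 * t - 1 ≤ 0 by linarith)]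
    ext A i j
    simp [hθ, hs1, hu1, triangularWeight]
  · have hs0 : s t = 0 := by
      simp [hs, Real.smoothTransition.one_of_one_le (show 1 ≤ 2 * t by linarith)]
    have hu0 : u t = 0 := by
      simp [hu, Real.smoothTransition.one_of_one_le (show 1 ≤ 2 * t - 1 by linarith)]
    ext A i j
    rw [hθ, hs0, hu0]
    rcases lt_trichotomy i j with hij | rfl | hij
    · have hij' : i.val < j.val := hij
      simp [triangularWeight, hij.ne, Nat.sub_ne_zero_of_lt hij']
    · simp [triangularWeight]
    · simp [upper A i j hij]
  · ext i j
    have hC : (C : Fin n → Fin n → ℝ) i j = _ := congrFun (congrFun h i) j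
    simp only [Matrix.of_apply, Matrix.sub_apply, Matrix.mul_apply, hθ] at hC ⊢
    rw [hC, ← Finset.sum_sub_distrib, ← Finset.sum_sub_distrib, Finset.mul_sum]
    refine Finset.sum_congr rfl fun k _ => ?_
    rw [triangularWeight_mul_commutator (hsu t) (upper A) (upper B)]
    ring
  · refine contDiff_of_contDiff_coe 𝔰𝔱 (contDiff_pi.2 fun i => contDiff_pi.2 fun j => ?_)
    simp only [hθ]
    refine ContDiff.mul ?_ ?_
    · by_cases hij : i = j
      · simp only [triangularWeight, hij, if_true]
        exact hu_smooth.comp contDiff_fst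
      · simp only [triangularWeight, hij, if_false]
        exact (hs_smooth.comp contDiff_fst).pow (j.val - i.val)
    · exact contDiff_pi.1 (contDiff_pi.1 (𝔰𝔱.subtypeL.contDiff.comp contDiff_snd) i) j
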